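/- Let k, k' ≥ 1 be integers and let 0 < b < b' and 0 ≤ c ≤ b be real numbers. Then −(1/(8π²)) · ∮_{|z|=√b} ∮_{|w|=√(b')} ( (z/√b)^{k} + (√b/z)^{k} ) · ( (w/√(b'))^{k'} + (√(b')/w)^{k'} ) · (c/b) · ((c/b)·z − w)^{−2} dw dz = δ_{k,k'}·(k/2)·( c/√(b·b') )^{k}, where ∮_{|z|=ρ} denotes the counterclockwise contour integral over the circle of radius ρ centered at 0 (including the factor dz), δ is the Kronecker delta, and the constant arises as 1/(2·(2πi)²) = −1/(8π²). -/

import Mathlib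

open MeasureTheory Complex Real

lemma aux_pow_inv (a : ℂ) (R : ℝ) (n : ℕ) (hn : n ≠ 1) :
    (∮ w in C(0, R), ((w - a) ^ n)⁻¹) = 0 := by
  have h := circleIntegral.integral_sub_zpow_of_ne (n := -(n : ℤ)) (by omega) 0 a R
  simpa using h

lemma aux_integrable (a : ℂ) (R : ℝ) (hR : 0 < R) (ha : ‖a‖ < R) (m n : ℕ) :
    CircleIntegrable (fun w => (w ^ m)⁻¹ * ((w - a) ^ n)⁻¹) 0 R := by
  apply ContinuousOn.circleIntegrable hR.le
  intro w hw
  have hw' : ‖w‖ = R := by simpa using hw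
  have h0 : w ≠ 0 := by
    rintro rfl
    simp at hw'
    linarith
  have h1 : w - a ≠ 0 := by
    intro h
    rw [sub_eq_zero] at h
    subst h
    linarith
  apply ContinuousAt.continuousWithinAt
  fun_prop (disch := simp [h0, h1])

lemma aux_zero (a : ℂ) (R : ℝ) (hR : 0 < R) (ha : ‖a‖ < R) (s : ℕ) : ∀ m n : ℕ, m + n = s →
    2 ≤ m + n → (∮ w in C(0, R), (w ^ m)⁻¹ * ((w - a) ^ n)⁻¹) = 0 := by
  by_cases ha0 : a = 0
  · intro m n _ h2
    subst ha0
    have := aux_pow_inv 0 R (m + n) (by omega)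
    simpa [pow_add, mul_comm] using this
  induction s with
  | zero => intro m n h h2; omega
  | succ s ih =>
    intro m n h h2
    rcases m with _ | m
    · simpa using aux_pow_inv a R n (by omega)
    rcases n with _ | n
    · simpa using aux_pow_inv 0 R (m + 1) (by omega)
    have key : (∮ w in C(0, R), (w ^ (m + 1))⁻¹ * ((w - a) ^ (n + 1))⁻¹) =
        ∮ w in C(0, R), a⁻¹ * ((w ^ m)⁻¹ * ((w - a) ^ (n + 1))⁻¹
          - (w ^ (m + 1))⁻¹ * ((w - a) ^ n)⁻¹) := by
      apply circleIntegral.integral_congr hR.le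
      intro w hw
      have hw' : ‖w‖ = R := by simpa using hw
      have h0 : w ≠ 0 := by
        rintro rfl
        simp at hw'
        linarith
      have h1 : w - a ≠ 0 := by
        intro h
        rw [sub_eq_zero] at h
        subst h
        linarith
      simp only
      field_simp
      ring
    rw [key, circleIntegral.integral_const_mul, circleIntegral.integral_sub
      (aux_integrable a R hR ha _ _) (aux_integrable a R hR ha _ _)]
    by_cases h3 : m = 0 ∧ n = 0
    · obtain ⟨rfl, rfl⟩ := h3
      have e1 := circleIntegral.integral_sub_inv_of_mem_ball (c := 0) (w := a) (R := R) (by simpa)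
      have e2 := circleIntegral.integral_sub_inv_of_mem_ball (c := 0) (w := 0) (R := R) (by simpa)
      simp only [sub_zero] at e2
      simp [e1, e2]
    · rw [ih m (n + 1) (by omega) (by omega), ih (m + 1) n (by omega) (by omega)]
      simp

lemma aux_pos (a : ℂ) (R : ℝ) (ha : ‖a‖ < R) (m : ℕ) :
    (∮ w in C(0, R), w ^ m * ((w - a) ^ 2)⁻¹) = 2 * π * I * (m * a ^ (m - 1)) := by
  have h := Complex.two_pi_I_inv_smul_circleIntegral_sub_sq_inv_smul_of_differentiable
    isOpen_univ (c := 0) (w₀ := a) (R := R) (f := fun w => w ^ m) (Set.subset_univ _)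
    (by fun_prop) (by simpa)
  have h2 : (2 * π * I : ℂ) ≠ 0 := by simp [Real.pi_ne_zero]
  rw [inv_smul_eq_iff₀ h2] at h
  simp only [smul_eq_mul] at h
  simp_rw [mul_comm (_ ^ m)]
  rw [h]
  simp

lemma aux_inner (a : ℂ) (R : ℝ) (hR : 0 < R) (ha : ‖a‖ < R) (m : ℕ) (C D : ℂ) :
    (∮ w in C(0, R), C * ((w / (R : ℂ)) ^ m + ((R : ℂ) / w) ^ m) * D * ((a - w) ^ 2)⁻¹) =
      C * D * (2 * π * I * (m * a ^ (m - 1)) / (R : ℂ) ^ m) := by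
  have e : ∀ w : ℂ, C * ((w / (R : ℂ)) ^ m + ((R : ℂ) / w) ^ m) * D * ((a - w) ^ 2)⁻¹ =
      C * D * ((((R : ℂ) ^ m)⁻¹ * (w ^ m * ((w - a) ^ 2)⁻¹)) +
        ((R : ℂ) ^ m * ((w ^ m)⁻¹ * ((w - a) ^ 2)⁻¹))) := by
    intro w
    rw [← neg_sub w a, neg_sq, div_pow, div_pow]
    ring
  simp_rw [e]
  have i1 : CircleIntegrable (fun w => w ^ m * ((w - a) ^ 2)⁻¹) 0 R := by
    have := (aux_integrable a R hR ha 0 2).continuousOn_mul (g := fun w => w ^ m) (by fun_prop)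
    simpa [Pi.mul_def] using this
  have i2 := aux_integrable a R hR ha m 2
  rw [circleIntegral.integral_const_mul, circleIntegral.integral_add
    (by simpa [Pi.smul_def] using i1.const_smul (a := ((R : ℂ) ^ m)⁻¹))
    (by simpa [Pi.smul_def] using i2.const_smul (a := (R : ℂ) ^ m)),
    circleIntegral.integral_const_mul, circleIntegral.integral_const_mul,
    aux_zero a R hR ha _ m 2 rfl (by omega), aux_pos a R ha]
  ring

lemma aux_outer (r : ℝ) (hr : 0 < r) (k m : ℕ) (hk : 1 ≤ k) :
    (∮ z in C(0, r), ((z / (r : ℂ)) ^ k + ((r : ℂ) / z) ^ k) * z ^ m) =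
      if k = m + 1 then 2 * π * I * (r : ℂ) ^ k else 0 := by
  have hz : ∀ n : ℤ, CircleIntegrable (fun z : ℂ => z ^ n) 0 r := by
    intro n
    have := circleIntegrable_sub_zpow_iff (c := 0) (w := 0) (R := r) (n := n)
    simp only [sub_zero] at this
    rw [this]
    right; right
    simp [hr.ne, abs_of_pos hr]
  have e : (∮ z in C(0, r), ((z / (r : ℂ)) ^ k + ((r : ℂ) / z) ^ k) * z ^ m) =
      ∮ z in C(0, r), (((r : ℂ) ^ k)⁻¹ * z ^ ((k + m : ℕ) : ℤ) +
        (r : ℂ) ^ k * z ^ ((m : ℤ) - k)) := by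
    apply circleIntegral.integral_congr hr.le
    intro w hw
    have hw' : ‖w‖ = r := by simpa using hw
    have h0 : w ≠ 0 := by
      rintro rfl
      simp at hw'
      linarith
    simp only
    rw [zpow_sub₀ h0, zpow_natCast, zpow_natCast, zpow_natCast, div_pow, div_pow, pow_add]
    ring
  rw [e, circleIntegral.integral_add
    (by simpa [Pi.smul_def] using (hz ((k + m : ℕ) : ℤ)).const_smul (a := ((r : ℂ) ^ k)⁻¹))
    (by simpa [Pi.smul_def] using (hz _).const_smul (a := (r : ℂ) ^ k)),
    circleIntegral.integral_const_mul, circleIntegral.integral_const_mul]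
  have z1 := circleIntegral.integral_sub_zpow_of_ne (n := ((k + m : ℕ) : ℤ)) (by omega) 0 0 r
  simp only [sub_zero] at z1
  rw [z1]
  split_ifs with h
  · have : (m : ℤ) - k = -1 := by omega
    have e2 := circleIntegral.integral_sub_center_inv 0 hr.ne'
    simp only [sub_zero] at e2
    simp only [this, zpow_neg_one, e2]
    ring
  · have z2 := circleIntegral.integral_sub_zpow_of_ne (n := (m : ℤ) - k) (by omega) 0 0 r
    simp only [sub_zero] at z2
    rw [z2]
    ring



/-- The double contour integral expressing the limiting covariance of traces of rescaled
Chebyshev polynomials evaluates to `δ_{k,k'} · (k/2) · (c/√(bb'))^k`: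
`−(1/(8π²)) ∮_{|z|=√b} ∮_{|w|=√b'} ((z/√b)^k + (√b/z)^k)((w/√b')^{k'} + (√b'/w)^{k'})
  (c/b) ((c/b)z − w)^{−2} dw dz = δ_{k,k'} (k/2) (c/√(bb'))^k`. -/
theorem chebyshev_contour_integral_eval (k k' : ℕ) (hk : 1 ≤ k) (hk' : 1 ≤ k')
    (b b' c : ℝ) (hb : 0 < b) (hbb' : b < b') (hc0 : 0 ≤ c) (hcb : c ≤ b) :
    -(1 / (8 * (Real.pi : ℂ) ^ 2)) *
        (∮ z in C(0, Real.sqrt b), ∮ w in C(0, Real.sqrt b'),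
          ((z / (Real.sqrt b : ℂ)) ^ k + ((Real.sqrt b : ℂ) / z) ^ k) *
            ((w / (Real.sqrt b' : ℂ)) ^ k' + ((Real.sqrt b' : ℂ) / w) ^ k') *
            ((c : ℂ) / (b : ℂ)) * ((((c : ℂ) / (b : ℂ)) * z - w) ^ 2)⁻¹) =
      if k = k' then ((k : ℂ) / 2) * ((c : ℂ) / (Real.sqrt (b * b') : ℂ)) ^ k else 0 := by

  have hb' : 0 < b' := hb.trans hbb'
  have hr : 0 < √b := Real.sqrt_pos.2 hb
  have hR : 0 < √b' := Real.sqrt_pos.2 hb'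
  have hrR : √b < √b' := Real.sqrt_lt_sqrt hb.le hbb'
  have hsq : ((√b : ℝ) : ℂ) * (√b : ℝ) = b := by
    rw [← Complex.ofReal_mul, Real.mul_self_sqrt hb.le]
  rw [Real.sqrt_mul hb.le]
  generalize √b' = R at *
  generalize √b = r at *
  have hr0 : (r : ℂ) ≠ 0 := by exact_mod_cast hr.ne'
  have hR0 : (R : ℂ) ≠ 0 := by exact_mod_cast hR.ne'
  obtain ⟨m, rfl⟩ : ∃ m, k' = m + 1 := ⟨k' - 1, by omega⟩
  have e : (∮ z in C(0, r), ∮ w in C(0, R),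
          ((z / (r : ℂ)) ^ k + ((r : ℂ) / z) ^ k) *
            ((w / (R : ℂ)) ^ (m + 1) + ((R : ℂ) / w) ^ (m + 1)) *
            ((c : ℂ) / (b : ℂ)) * ((((c : ℂ) / (b : ℂ)) * z - w) ^ 2)⁻¹) =
      ∮ z in C(0, r), (2 * π * I * (m + 1 : ℕ) * (c / b : ℂ) ^ (m + 1) / (R : ℂ) ^ (m + 1)) *
        (((z / (r : ℂ)) ^ k + ((r : ℂ) / z) ^ k) * z ^ m) := by
    apply circleIntegral.integral_congr hr.le
    intro z hz
    have hz' : ‖z‖ = r := by simpa using hz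
    have ha : ‖((c : ℂ) / (b : ℂ)) * z‖ < R := by
      rw [norm_mul, norm_div, Complex.norm_of_nonneg hc0, Complex.norm_of_nonneg hb.le, hz']
      have : c / b ≤ 1 := (div_le_one hb).2 hcb
      nlinarith
    simp only
    rw [aux_inner _ R hR ha]
    simp only [Nat.add_sub_cancel]
    rw [mul_pow]
    ring
  rw [e, circleIntegral.integral_const_mul, aux_outer r hr k m hk]
  split_ifs with h
  · subst h
    have hpi : (π : ℂ) ≠ 0 := by simp [Real.pi_ne_zero]
    rw [← hsq]
    push_cast
    have hI : I ^ 2 = -1 := I_sq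
    simp only [div_pow, mul_pow]
    field_simp
    rw [hI]
    ring
  · simp
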